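/- Consider the set Γ_S of bijections φ : M₃(ℂ) → M₃(ℂ) of the form φ(X) = P·X·P⁻¹ or φ(X) = P·Xᵀ·P⁻¹ for some P ∈ GL₃(ℂ), such that for every i ∈ {1,…,18} there exist j ∈ {1,…,18} and k ∈ {0,1,2} with φ(mᵢ) = ζᵏ·mⱼ. Then Γ_S is a group under composition and has exactly 432 elements; moreover the subset of Γ_S consisting of the pure conjugations φ(X) = P·X·P⁻¹ is a normal subgroup of index 2 with exactly 216 elements. (This is Theorem 2: the symmetry group of the decomposition is (ℤ₃² ⋊ SL(2,𝔽₃)) ⋊ ℤ₂, of order 432.) -/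

import Mathlib

open Matrix

noncomputable def ζ : ℂ := Complex.exp (2 * Real.pi * Complex.I / 3)

noncomputable def a : ℂ := (((-((2 : ℝ) ^ (-(1/3 : ℝ)))) : ℝ) : ℂ)

noncomputable def m : Fin 18 → Matrix (Fin 3) (Fin 3) ℂ :=
  ![!![1, -1, 0; -1, 1, 0; 0, 0, 0],
    !![0, 0, 0; 0, 1, -ζ; 0, -ζ^2, 1],
    !![1, 0, -ζ; 0, 0, 0; -ζ^2, 0, 1],
    !![0, 0, 0; 0, 1, -ζ^2; 0, -ζ, 1],
    !![1, 0, -1; 0, 0, 0; -1, 0, 1],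
    !![1, -ζ, 0; -ζ^2, 1, 0; 0, 0, 0],
    !![1, 0, -ζ^2; 0, 0, 0; -ζ, 0, 1],
    !![1, -ζ^2, 0; -ζ, 1, 0; 0, 0, 0],
    !![0, 0, 0; 0, 1, -1; 0, -1, 1],
    a • (1 : Matrix (Fin 3) (Fin 3) ℂ),
    !![0, 1, 0; 0, 0, ζ; ζ^2, 0, 0],
    !![0, 0, 1; ζ^2, 0, 0; 0, ζ, 0],
    !![0, 1, 0; 0, 0, ζ^2; ζ, 0, 0],
    !![0, 0, 1; 1, 0, 0; 0, 1, 0],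
    !![1, 0, 0; 0, ζ, 0; 0, 0, ζ^2],
    !![0, 0, 1; ζ, 0, 0; 0, ζ^2, 0],
    !![1, 0, 0; 0, ζ^2, 0; 0, 0, ζ],
    !![0, 1, 0; 0, 0, 1; 1, 0, 0]]

/-- φ is conjugation by an invertible matrix P. -/
def IsConjugation (φ : Equiv.Perm (Matrix (Fin 3) (Fin 3) ℂ)) : Prop :=
  ∃ P : Matrix (Fin 3) (Fin 3) ℂ, IsUnit P ∧ ∀ X, φ X = P * X * P⁻¹

/-- φ is transpose followed by conjugation by an invertible matrix P. -/
def IsTransposeConjugation (φ : Equiv.Perm (Matrix (Fin 3) (Fin 3) ℂ)) : Prop :=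
  ∃ P : Matrix (Fin 3) (Fin 3) ℂ, IsUnit P ∧ ∀ X, φ X = P * Xᵀ * P⁻¹

/-- φ permutes the summands of the Waring decomposition up to powers of ζ. -/
def FixesDecomposition (φ : Equiv.Perm (Matrix (Fin 3) (Fin 3) ℂ)) : Prop :=
  ∀ i : Fin 18, ∃ (j : Fin 18) (k : Fin 3), φ (m i) = ζ ^ (k : ℕ) • m j

open scoped Pointwise

abbrev Mat3 : Type := Matrix (Fin 3) (Fin 3) ℂ

lemma zeta_isPrimitiveRoot : IsPrimitiveRoot ζ 3 := by
  simpa [ζ] using Complex.isPrimitiveRoot_exp 3 (by norm_num)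

lemma zeta_pow_three : ζ ^ 3 = 1 := zeta_isPrimitiveRoot.pow_eq_one

lemma zeta_ne_zero : ζ ≠ 0 := zeta_isPrimitiveRoot.ne_zero (by norm_num)

lemma zeta_ne_one : ζ ≠ 1 := zeta_isPrimitiveRoot.ne_one (by norm_num)

lemma a_pow_three : a ^ 3 = -1 / 2 := by
  have h : ((2 : ℝ) ^ (-(1 / 3 : ℝ))) ^ 3 = 1 / 2 := by
    rw [← Real.rpow_natCast, ← Real.rpow_mul (by norm_num)]
    norm_num [Real.rpow_neg_one]
  have h' : (-((2 : ℝ) ^ (-(1 / 3 : ℝ)))) ^ 3 = -1 / 2 := by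
    rw [neg_pow, h]; norm_num
  unfold a
  exact_mod_cast h'

/-- The additive character of `ℤ/3` with values in the powers of `ζ`. -/
noncomputable def zetaChar (n : Fin 3) : ℂ := ζ ^ (n : ℕ)

lemma zetaChar_add (x y : Fin 3) : zetaChar (x + y) = zetaChar x * zetaChar y := by
  unfold zetaChar
  rw [← pow_add, ← pow_mod_orderOf ζ (x + y : ℕ), ← zeta_isPrimitiveRoot.eq_orderOf, Fin.val_add]

lemma zetaChar_injective : Function.Injective zetaChar := fun x y h =>
  Fin.ext (zeta_isPrimitiveRoot.pow_inj x.isLt y.isLt h)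

lemma zetaChar_ne_zero (x : Fin 3) : zetaChar x ≠ 0 := pow_ne_zero _ zeta_ne_zero

lemma zetaChar_zero : zetaChar 0 = 1 := by simp [zetaChar]

lemma zetaChar_one : zetaChar 1 = ζ := by simp [zetaChar]

lemma zetaChar_two : zetaChar 2 = ζ ^ 2 := by simp [zetaChar]

/-- Labels `(z, x, c)` of the elements `ζ ^ c Z ^ z X ^ x` of the Heisenberg group. -/
abbrev HeisLabel : Type := Fin 3 × Fin 3 × Fin 3

/-- The Heisenberg matrix `ζ ^ c Z ^ z X ^ x`. -/
noncomputable def heis (p : HeisLabel) : Mat3 :=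
  of fun i j => if j = i + p.2.1 then zetaChar (p.2.2 + p.1 * i) else 0

/-- The reflection (displaced parity operator) with parameters `s`. -/
noncomputable def refl3 (s : Fin 3 × Fin 3) : Mat3 :=
  of fun i j => if j = s.1 - i then zetaChar (s.2 * (i - j)) else 0

lemma heis_mul (p q : HeisLabel) :
    heis p * heis q = heis (p.1 + q.1, p.2.1 + q.2.1, p.2.2 + q.2.2 + p.2.1 * q.1) := by
  obtain ⟨z, x, c⟩ := p
  obtain ⟨z', x', c'⟩ := q
  ext i k
  have h : c + z * i + (c' + z' * (i + x)) = c + c' + x * z' + (z + z') * i := by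
    revert c c' z z' i x; decide
  rw [mul_apply, Finset.sum_eq_single (i + x) (by simp +contextual [heis]) (by simp)]
  simp [heis, ← zetaChar_add, h, add_assoc i]

lemma zetaChar_smul_heis (n : Fin 3) (p : HeisLabel) :
    zetaChar n • heis p = heis (p.1, p.2.1, n + p.2.2) := by
  ext i k
  simp [heis, ← zetaChar_add, add_assoc n]

lemma heis_injective : Function.Injective heis := by
  rintro ⟨z, x, c⟩ ⟨z', x', c'⟩ h
  have key (i : Fin 3) : x = x' ∧ c + z * i = c' + z' * i := by
    have := congr_fun (congr_fun h i) (i + x)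
    by_cases hx : x = x'
    · subst hx
      exact ⟨rfl, zetaChar_injective (by simpa [heis] using this)⟩
    · simp [heis, hx, zetaChar_ne_zero] at this
  have h0 := (key 0).2
  have h1 := (key 1).2
  have hx := (key 0).1
  simp only [mul_zero, add_zero, mul_one] at h0 h1
  subst h0
  rw [add_left_cancel h1, hx]

/-- The label of `X`. -/
def labelX : HeisLabel := (0, 1, 0)

/-- The label of `Z`. -/
def labelZ : HeisLabel := (1, 0, 0)

/-- The set of all `ζ ^ k • m j`. -/
def summands : Set Mat3 := Set.range fun jk : Fin 18 × Fin 3 => zetaChar jk.2 • m jk.1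

/-- Parameters of the reflections belonging to the first nine summands. -/
def reflIndex : Fin 9 → Fin 3 × Fin 3 :=
  ![(1, 0), (0, 2), (2, 1), (0, 1), (2, 0), (1, 2), (2, 2), (1, 1), (0, 0)]

/-- Labels of the last eight summands. -/
def heisIndex : Fin 8 → HeisLabel :=
  ![(1, 1, 0), (2, 2, 0), (2, 1, 0), (0, 2, 0), (1, 0, 0), (1, 2, 0), (2, 0, 0), (0, 1, 0)]

lemma m_castLE (j : Fin 9) :
    m (j.castLE (by norm_num)) = 1 - refl3 (reflIndex j) := by
  fin_cases j <;> ext i k <;> fin_cases i <;> fin_cases k <;>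
    simp [m, refl3, reflIndex, zetaChar, show (-1 : Fin 3) = 2 from rfl,
      show (-2 : Fin 3) = 1 from rfl]

lemma m_natAdd (j : Fin 8) : m (j.natAdd 10) = heis (heisIndex j) := by
  fin_cases j <;> ext i k <;> fin_cases i <;> fin_cases k <;>
    simp [m, heis, heisIndex, zetaChar]

lemma m_nine : m 9 = a • (1 : Mat3) := rfl

lemma summand_cases (P : Mat3 → Prop) (hrefl : ∀ j, P (1 - refl3 (reflIndex j)))
    (hone : P (a • 1)) (hheis : ∀ j, P (heis (heisIndex j))) (i : Fin 18) : P (m i) := by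
  by_cases h : (i : ℕ) < 9
  · have := m_castLE ⟨i, h⟩ ▸ hrefl ⟨i, h⟩
    exact this
  · by_cases h' : (i : ℕ) = 9
    · have : i = 9 := Fin.ext h'
      rw [this]; exact hone
    · have := m_natAdd ⟨i - 10, by omega⟩ ▸ hheis ⟨i - 10, by omega⟩
      have hi : Fin.natAdd 10 (⟨i - 10, by omega⟩ : Fin 8) = i := Fin.ext (by simp; omega)
      rwa [hi] at this

/-- The label of a non-scalar Heisenberg matrix. -/
def NonCentral (p : HeisLabel) : Prop := p.1 ≠ 0 ∨ p.2.1 ≠ 0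

instance : DecidablePred NonCentral := fun p => inferInstanceAs (Decidable (p.1 ≠ 0 ∨ p.2.1 ≠ 0))

lemma exists_summand_of_nonCentral (p : HeisLabel) (hp : NonCentral p) :
    ∃ (j : Fin 18) (k : Fin 3), heis p = ζ ^ (k : ℕ) • m j := by
  have h : ∀ p, NonCentral p → ∃ (j : Fin 8) (k : Fin 3),
      p = ((heisIndex j).1, (heisIndex j).2.1, k + (heisIndex j).2.2) := by decide
  obtain ⟨j, k, hjk⟩ := h p hp
  refine ⟨j.natAdd 10, k, ?_⟩
  rw [m_natAdd, hjk, ← zetaChar_smul_heis, zetaChar]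

lemma exists_summand_refl3 (s : Fin 3 × Fin 3) : ∃ j : Fin 18, 1 - refl3 s = m j := by
  have h : ∀ s, ∃ j, s = reflIndex j := by decide
  obtain ⟨j, rfl⟩ := h s
  exact ⟨_, (m_castLE j).symm⟩

/-- Conjugation by invertible matrices, as a group homomorphism. -/
def conjPerm : Mat3ˣ →* Equiv.Perm Mat3 :=
  (MulAction.toPermHom (ConjAct Mat3ˣ) Mat3).comp ConjAct.toConjAct.toMonoidHom

lemma conjPerm_apply (P : Mat3ˣ) (X : Mat3) : conjPerm P X = P * X * (P⁻¹ : Mat3ˣ) := rfl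

/-- Transposition of matrices, as a permutation. -/
def transposePerm : Equiv.Perm Mat3 where
  toFun X := Xᵀ
  invFun X := Xᵀ
  left_inv X := transpose_transpose X
  right_inv X := transpose_transpose X

lemma transposePerm_apply (X : Mat3) : transposePerm X = Xᵀ := rfl

lemma transposePerm_mul_self : transposePerm * transposePerm = 1 :=
  Equiv.ext fun X => transpose_transpose X

lemma isConjugation_iff (φ : Equiv.Perm Mat3) : IsConjugation φ ↔ ∃ P, φ = conjPerm P := by
  constructor
  · rintro ⟨_, ⟨P, rfl⟩, h⟩
    exact ⟨P, Equiv.ext fun X => by rw [h, conjPerm_apply, coe_units_inv]⟩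
  · rintro ⟨P, rfl⟩
    exact ⟨P, P.isUnit, fun X => by rw [conjPerm_apply, coe_units_inv]⟩

lemma isTransposeConjugation_iff (φ : Equiv.Perm Mat3) :
    IsTransposeConjugation φ ↔ ∃ P, φ = conjPerm P * transposePerm := by
  constructor
  · rintro ⟨_, ⟨P, rfl⟩, h⟩
    exact ⟨P, Equiv.ext fun X => by
      rw [h, Equiv.Perm.mul_apply, conjPerm_apply, coe_units_inv, transposePerm_apply]⟩
  · rintro ⟨P, rfl⟩
    exact ⟨P, P.isUnit, fun X => by
      rw [Equiv.Perm.mul_apply, conjPerm_apply, coe_units_inv, transposePerm_apply]⟩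

lemma transposePerm_mul_conjPerm (P : Mat3ˣ) :
    ∃ Q, transposePerm * conjPerm P = conjPerm Q * transposePerm := by
  refine ⟨⟨((P⁻¹ : Mat3ˣ) : Mat3)ᵀ, (P : Mat3)ᵀ, ?_, ?_⟩, Equiv.ext fun X => ?_⟩
  · rw [← transpose_mul, Units.mul_inv, transpose_one]
  · rw [← transpose_mul, Units.inv_mul, transpose_one]
  · simp [Equiv.Perm.mul_apply, conjPerm_apply, transposePerm_apply, mul_assoc]

/-- The group of all conjugations and transpose conjugations. -/
def conjTransposeGroup : Subgroup (Equiv.Perm Mat3) where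
  carrier := {φ | IsConjugation φ ∨ IsTransposeConjugation φ}
  one_mem' := Or.inl ((isConjugation_iff 1).mpr ⟨1, (map_one _).symm⟩)
  mul_mem' := by
    simp only [Set.mem_ofPred_eq, isConjugation_iff, isTransposeConjugation_iff]
    rintro _ _ (⟨P, rfl⟩ | ⟨P, rfl⟩) (⟨Q, rfl⟩ | ⟨Q, rfl⟩)
    · exact Or.inl ⟨P * Q, (map_mul _ _ _).symm⟩
    · exact Or.inr ⟨P * Q, by rw [map_mul, mul_assoc]⟩
    · obtain ⟨R, hR⟩ := transposePerm_mul_conjPerm Q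
      exact Or.inr ⟨P * R, by rw [mul_assoc, hR, map_mul, mul_assoc]⟩
    · obtain ⟨R, hR⟩ := transposePerm_mul_conjPerm Q
      exact Or.inl ⟨P * R, by
        rw [mul_assoc, ← mul_assoc transposePerm, hR, mul_assoc (conjPerm R),
          transposePerm_mul_self, map_mul, mul_one]⟩
  inv_mem' := by
    simp only [Set.mem_ofPred_eq, isConjugation_iff, isTransposeConjugation_iff]
    rintro _ (⟨P, rfl⟩ | ⟨P, rfl⟩)
    · exact Or.inl ⟨P⁻¹, (map_inv _ _).symm⟩
    · obtain ⟨R, hR⟩ := transposePerm_mul_conjPerm P⁻¹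
      exact Or.inr ⟨R, by
        rw [_root_.mul_inv_rev, ← map_inv, ← hR, inv_eq_of_mul_eq_one_left transposePerm_mul_self]⟩

/-- Linear maps fixing the identity matrix. -/
structure IsUnitalLinear (φ : Equiv.Perm Mat3) : Prop where
  one : φ 1 = 1
  sub : ∀ X Y, φ (X - Y) = φ X - φ Y
  smul : ∀ (c : ℂ) X, φ (c • X) = c • φ X

lemma isUnitalLinear_of_mem {φ : Equiv.Perm Mat3} (hφ : φ ∈ conjTransposeGroup) :
    IsUnitalLinear φ := by
  obtain h | h := hφ
  · obtain ⟨P, rfl⟩ := (isConjugation_iff _).mp h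
    constructor <;> intros <;> simp [conjPerm_apply, mul_sub, sub_mul]
  · obtain ⟨P, rfl⟩ := (isTransposeConjugation_iff _).mp h
    constructor <;> intros <;>
      simp [Equiv.Perm.mul_apply, conjPerm_apply, transposePerm_apply, mul_sub, sub_mul]

lemma fixesDecomposition_iff_mem_stabilizer {φ : Equiv.Perm Mat3} (hφ : IsUnitalLinear φ) :
    FixesDecomposition φ ↔ φ ∈ MulAction.stabilizer (Equiv.Perm Mat3) summands := by
  have hfin : summands.Finite := Set.finite_range _
  rw [MulAction.mem_stabilizer_set' hfin]
  constructor
  · rintro h _ ⟨⟨i, n⟩, rfl⟩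
    obtain ⟨j, k, hjk⟩ := h i
    refine ⟨(j, n + k), ?_⟩
    simp only [Equiv.Perm.smul_def, hφ.smul, hjk, zetaChar_add, mul_smul]
    rfl
  · intro h i
    obtain ⟨⟨j, k⟩, hjk⟩ := h (b := m i) ⟨(i, 0), by simp [zetaChar_zero]⟩
    exact ⟨j, k, hjk.symm⟩

lemma fixesDecomposition_of_action {φ : Equiv.Perm Mat3} (hφ : IsUnitalLinear φ)
    (hheis : ∀ p, NonCentral p → ∃ q, NonCentral q ∧ φ (heis p) = heis q)
    (hrefl : ∀ s, ∃ t, φ (refl3 s) = refl3 t) : FixesDecomposition φ := by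
  refine fun i => summand_cases (fun X => ∃ (j : Fin 18) (k : Fin 3), φ X = ζ ^ (k : ℕ) • m j)
    (fun j => ?_) ⟨9, 0, ?_⟩ (fun j => ?_) i
  · obtain ⟨t, ht⟩ := hrefl (reflIndex j)
    obtain ⟨l, hl⟩ := exists_summand_refl3 t
    exact ⟨l, 0, by simp [hφ.sub, hφ.one, ht, hl]⟩
  · simp [hφ.smul, hφ.one, m_nine]
  · have h : ∀ j, NonCentral (heisIndex j) := by decide
    obtain ⟨q, hq, hq'⟩ := hheis _ (h j)
    rw [hq']
    exact exists_summand_of_nonCentral q hq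

/-- The conjugations that preserve the decomposition. -/
def pureSymmetries : Subgroup (Equiv.Perm Mat3) :=
  conjPerm.range ⊓ MulAction.stabilizer (Equiv.Perm Mat3) summands

lemma mem_pureSymmetries (φ : Equiv.Perm Mat3) :
    φ ∈ pureSymmetries ↔ IsConjugation φ ∧ FixesDecomposition φ := by
  have h : φ ∈ conjPerm.range ↔ IsConjugation φ := by
    rw [isConjugation_iff, MonoidHom.mem_range]
    simp only [eq_comm]
  rw [pureSymmetries, Subgroup.mem_inf, h, and_congr_right_iff]
  exact fun hφ => (fixesDecomposition_iff_mem_stabilizer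
    (isUnitalLinear_of_mem (Or.inl hφ))).symm

/-- The conjugations and transpose conjugations that preserve the decomposition. -/
def symmetries : Subgroup (Equiv.Perm Mat3) :=
  conjTransposeGroup ⊓ MulAction.stabilizer (Equiv.Perm Mat3) summands

lemma mem_symmetries (φ : Equiv.Perm Mat3) : φ ∈ symmetries ↔
    (IsConjugation φ ∨ IsTransposeConjugation φ) ∧ FixesDecomposition φ := by
  rw [symmetries, Subgroup.mem_inf]
  exact and_congr_right fun hφ => (fixesDecomposition_iff_mem_stabilizer
    (isUnitalLinear_of_mem hφ)).symm

lemma pureSymmetries_le : pureSymmetries ≤ symmetries := fun φ hφ => by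
  rw [mem_symmetries]
  rw [mem_pureSymmetries] at hφ
  exact ⟨Or.inl hφ.1, hφ.2⟩

lemma transposePerm_mem_symmetries : transposePerm ∈ symmetries := by
  have h : IsTransposeConjugation transposePerm :=
    (isTransposeConjugation_iff _).mpr ⟨1, by rw [map_one, one_mul]⟩
  refine (mem_symmetries _).mpr ⟨Or.inr h, fixesDecomposition_of_action
    (isUnitalLinear_of_mem (Or.inr h)) (fun p hp => ?_) (fun s => ⟨(s.1, -s.2), ?_⟩)⟩
  · refine ⟨(p.1, -p.2.1, p.2.2 - p.1 * p.2.1), ?_, ?_⟩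
    · simpa [NonCentral] using hp
    · obtain ⟨z, x, c⟩ := p
      ext i j
      have h1 : ∀ i j x : Fin 3, i = j + x ↔ j = i + -x := by decide
      have h2 : ∀ c z x i : Fin 3, c - z * x + z * i = c + z * (i + -x) := by decide
      simp only [transposePerm_apply, transpose_apply, heis, of_apply, h1 i j x, h2]
      split_ifs with h <;> simp [h]
  · obtain ⟨s, t⟩ := s
    ext i j
    have h1 : ∀ i j s : Fin 3, i = s - j ↔ j = s - i := by decide
    have h2 : ∀ i j t : Fin 3, t * (j - i) = -t * (i - j) := by decide
    simp only [transposePerm_apply, transpose_apply, refl3, of_apply, h1 i j s, h2 i j t]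

lemma exists_pureSymmetry {P : Mat3} (hP : IsUnit P) {g : HeisLabel → HeisLabel}
    (hg : ∀ p, NonCentral p → NonCentral (g p)) {r : Fin 3 × Fin 3 → Fin 3 × Fin 3}
    (hheis : ∀ p, P * heis p = heis (g p) * P) (hrefl : ∀ s, P * refl3 s = refl3 (r s) * P) :
    ∃ φ ∈ pureSymmetries, ∀ p, φ (heis p) = heis (g p) := by
  obtain ⟨P, rfl⟩ := hP
  have h : IsConjugation (conjPerm P) := (isConjugation_iff _).mpr ⟨P, rfl⟩
  have hh (p) : conjPerm P (heis p) = heis (g p) := by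
    rw [conjPerm_apply, hheis, Units.mul_inv_cancel_right]
  refine ⟨conjPerm P, (mem_pureSymmetries _).mpr ⟨h, fixesDecomposition_of_action
    (isUnitalLinear_of_mem (Or.inl h)) (fun p hp => ⟨g p, hg p hp, hh p⟩)
    (fun s => ⟨r s, ?_⟩)⟩, hh⟩
  rw [conjPerm_apply, hrefl, Units.mul_inv_cancel_right]

/-- The action on labels of conjugation by `X`. -/
def actX (p : HeisLabel) : HeisLabel := (p.1, p.2.1, p.2.2 + p.1)

/-- The action on labels of conjugation by `Z`. -/
def actZ (p : HeisLabel) : HeisLabel := (p.1, p.2.1, p.2.2 - p.2.1)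

/-- The action on labels of conjugation by the Fourier matrix. -/
def actF (p : HeisLabel) : HeisLabel := (-p.2.1, p.1, p.2.2 - p.1 * p.2.1)

/-- The action on labels of conjugation by the phase matrix `diag(1, 1, ζ)`. -/
def actD (p : HeisLabel) : HeisLabel :=
  (p.1 + 2 * p.2.1, p.2.1, p.2.2 + p.2.1 * p.2.1 - p.2.1)

lemma heis_zero : heis (0, 0, 0) = 1 := by
  ext i j
  simp [heis, one_apply, zetaChar_zero, eq_comm]

lemma isUnit_heis (p : HeisLabel) : IsUnit (heis p) := by
  have h : ∀ p : HeisLabel, ∃ q : HeisLabel,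
      (p.1 + q.1, p.2.1 + q.2.1, p.2.2 + q.2.2 + p.2.1 * q.1) = (0, 0, 0) := by decide
  obtain ⟨q, hq⟩ := h p
  exact IsUnit.of_mul_eq_one _ (by rw [heis_mul, hq, heis_zero])

lemma heis_apply_mul (p : HeisLabel) (A : Mat3) (i k : Fin 3) :
    (heis p * A) i k = zetaChar (p.2.2 + p.1 * i) * A (i + p.2.1) k := by
  rw [mul_apply, Finset.sum_eq_single (i + p.2.1) (by simp +contextual [heis]) (by simp)]
  simp [heis]

lemma mul_heis_apply (A : Mat3) (p : HeisLabel) (i k : Fin 3) :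
    (A * heis p) i k = A i (k - p.2.1) * zetaChar (p.2.2 + p.1 * (k - p.2.1)) := by
  have h : ∀ k j x : Fin 3, k = j + x ↔ j = k - x := by decide
  rw [mul_apply, Finset.sum_eq_single (k - p.2.1) (by simp +contextual [heis, h k]) (by simp)]
  simp [heis]

lemma refl3_mul_apply (s : Fin 3 × Fin 3) (A : Mat3) (i k : Fin 3) :
    (refl3 s * A) i k = zetaChar (s.2 * (i - (s.1 - i))) * A (s.1 - i) k := by
  rw [mul_apply, Finset.sum_eq_single (s.1 - i) (by simp +contextual [refl3]) (by simp)]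
  simp [refl3]

lemma mul_refl3_apply (A : Mat3) (s : Fin 3 × Fin 3) (i k : Fin 3) :
    (A * refl3 s) i k = A i (s.1 - k) * zetaChar (s.2 * (s.1 - k - k)) := by
  have h : ∀ k j x : Fin 3, k = x - j ↔ j = x - k := by decide
  rw [mul_apply, Finset.sum_eq_single (s.1 - k) (by simp +contextual [refl3, h k]) (by simp)]
  simp [refl3]

lemma exists_actX : ∃ φ ∈ pureSymmetries, ∀ p, φ (heis p) = heis (actX p) := by
  refine exists_pureSymmetry (isUnit_heis labelX) (g := actX) (by decide)
    (r := fun s => (s.1 + 1, s.2)) (fun p => ?_) (fun s => ?_)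
  · rw [heis_mul, heis_mul]
    congr 1
    revert p; decide
  · obtain ⟨s, t⟩ := s
    ext i k
    have h1 : ∀ s i k : Fin 3, k = s - (i + 1) ↔ k - 1 = s + 1 - i := by decide
    have h2 : ∀ i k : Fin 3, i + 1 - k = i - (k - 1) := by decide
    simp [heis_apply_mul, mul_heis_apply, refl3, labelX, zetaChar_zero, h1 s i k, h2 i k]

lemma exists_actZ : ∃ φ ∈ pureSymmetries, ∀ p, φ (heis p) = heis (actZ p) := by
  refine exists_pureSymmetry (isUnit_heis labelZ) (g := actZ) (by decide)
    (r := fun s => (s.1, s.2 + 1)) (fun p => ?_) (fun s => ?_)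
  · rw [heis_mul, heis_mul]
    congr 1
    revert p; decide
  · obtain ⟨s, t⟩ := s
    ext i k
    have h : ∀ s t i : Fin 3, i + t * (i - (s - i)) = (t + 1) * (i - (s - i)) + (s - i) := by
      decide
    simp only [heis_apply_mul, mul_heis_apply, refl3, labelZ, of_apply, zero_add, add_zero,
      sub_zero, one_mul]
    split_ifs with hk
    · rw [hk, ← zetaChar_add, ← zetaChar_add, h]
    · simp

/-- The Fourier matrix. -/
noncomputable def fourier3 : Mat3 := of fun i j => zetaChar (i * j)

lemma isUnit_fourier3 : IsUnit fourier3 := by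
  rw [isUnit_iff_isUnit_det, isUnit_iff_ne_zero]
  have h : fourier3.det = 3 * ζ * (ζ - 1) := by
    simp [det_fin_three, fourier3, show (2 * 2 : Fin 3) = 1 from rfl, zetaChar_zero,
      zetaChar_one, zetaChar_two]
    linear_combination -ζ * zeta_pow_three
  rw [h]
  exact mul_ne_zero (mul_ne_zero (by norm_num) zeta_ne_zero) (sub_ne_zero.mpr zeta_ne_one)

lemma exists_actF : ∃ φ ∈ pureSymmetries, ∀ p, φ (heis p) = heis (actF p) := by
  refine exists_pureSymmetry isUnit_fourier3 (g := actF) (by decide)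
    (r := fun s => (s.2, -s.1)) (fun p => ?_) (fun s => ?_)
  · obtain ⟨z, x, c⟩ := p
    ext i k
    have h : ∀ z x c i k : Fin 3, i * (k - x) + (c + z * (k - x)) =
      c - z * x + -x * i + (i + z) * k := by decide
    simp only [mul_heis_apply, heis_apply_mul, fourier3, actF, of_apply, ← zetaChar_add, h]
  · obtain ⟨s, t⟩ := s
    ext i k
    have h : ∀ s t i k : Fin 3, i * (s - k) + t * (s - k - k) =
      -s * (i - (t - i)) + (t - i) * k := by decide
    simp only [mul_refl3_apply, refl3_mul_apply, fourier3, of_apply, ← zetaChar_add, h]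

/-- The phase matrix `diag(1, 1, ζ)`. -/
noncomputable def phase3 : Mat3 := diagonal fun i => zetaChar (2 * i * i - 2 * i)

lemma isUnit_phase3 : IsUnit phase3 := by
  rw [isUnit_iff_isUnit_det, isUnit_iff_ne_zero, phase3, det_diagonal]
  exact Finset.prod_ne_zero_iff.mpr fun _ _ => zetaChar_ne_zero _

lemma exists_actD : ∃ φ ∈ pureSymmetries, ∀ p, φ (heis p) = heis (actD p) := by
  refine exists_pureSymmetry isUnit_phase3 (g := actD) (by decide)
    (r := fun s => (s.1, s.2 + 2 * (s.1 - 1))) (fun p => ?_) (fun s => ?_)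
  · obtain ⟨z, x, c⟩ := p
    ext i k
    have h : ∀ z x c i : Fin 3, 2 * i * i - 2 * i + (c + z * i) =
      c + x * x - x + (z + 2 * x) * i + (2 * (i + x) * (i + x) - 2 * (i + x)) := by decide
    change _ = (heis (z + 2 * x, x, c + x * x - x) * phase3) i k
    simp only [phase3, diagonal_mul, mul_diagonal, heis, of_apply]
    split_ifs with hk
    · rw [hk, ← zetaChar_add, ← zetaChar_add, h]
    · simp
  · obtain ⟨s, t⟩ := s
    ext i k
    have h : ∀ s t i : Fin 3, 2 * i * i - 2 * i + t * (i - (s - i)) =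
      (t + 2 * (s - 1)) * (i - (s - i)) + (2 * (s - i) * (s - i) - 2 * (s - i)) := by decide
    simp only [phase3, diagonal_mul, mul_diagonal, refl3, of_apply]
    split_ifs with hk
    · rw [hk, ← zetaChar_add, ← zetaChar_add, h]
    · simp

/-- The pairs of labels whose matrices satisfy the commutation relation of `X` and `Z`. -/
abbrev SymplecticPair : Type :=
  {t : HeisLabel × HeisLabel // t.1.2.1 * t.2.1 = 1 + t.2.2.1 * t.1.1}

lemma card_symplecticPair : Nat.card SymplecticPair = 216 := by
  rw [Nat.card_eq_fintype_card]
  decide +kernel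

/-- The pair `(p, q)` of labels is the image of `(X, Z)` under a symmetry. -/
def IsReachable (p q : HeisLabel) : Prop :=
  ∃ φ ∈ pureSymmetries, φ (heis labelX) = heis p ∧ φ (heis labelZ) = heis q

lemma isReachable_of_act {g : HeisLabel → HeisLabel}
    (hg : ∃ φ ∈ pureSymmetries, ∀ p, φ (heis p) = heis (g p)) {p q : HeisLabel}
    (h : IsReachable (g p) (g q)) : IsReachable p q := by
  obtain ⟨φ, hφ, hφg⟩ := hg
  obtain ⟨ψ, hψ, hp, hq⟩ := h
  refine ⟨φ⁻¹ * ψ, mul_mem (inv_mem hφ) hψ, ?_, ?_⟩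
  · rw [Equiv.Perm.mul_apply, hp, ← hφg, Equiv.Perm.inv_def, Equiv.symm_apply_apply]
  · rw [Equiv.Perm.mul_apply, hq, ← hφg, Equiv.Perm.inv_def, Equiv.symm_apply_apply]

lemma isReachable_of_iterate {g : HeisLabel → HeisLabel}
    (hg : ∃ φ ∈ pureSymmetries, ∀ p, φ (heis p) = heis (g p)) (n : ℕ) {p q : HeisLabel}
    (h : IsReachable (g^[n] p) (g^[n] q)) : IsReachable p q := by
  induction n generalizing p q with
  | zero => exact h
  | succ n ih => exact isReachable_of_act hg (ih h)

lemma isReachable_of_linear_eq {p q : HeisLabel} (hp : (p.1, p.2.1) = (0, 1))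
    (hq : (q.1, q.2.1) = (1, 0)) : IsReachable p q := by
  have h : ∀ c d : Fin 3, ∃ i j : Fin 3,
      actX^[i] (actZ^[j] (0, 1, c)) = labelX ∧ actX^[i] (actZ^[j] (1, 0, d)) = labelZ := by
    decide
  obtain ⟨z, x, c⟩ := p
  obtain ⟨z', x', d⟩ := q
  obtain ⟨rfl, rfl⟩ := Prod.mk.inj hp
  obtain ⟨rfl, rfl⟩ := Prod.mk.inj hq
  obtain ⟨i, j, hi, hj⟩ := h c d
  refine isReachable_of_iterate exists_actZ j (isReachable_of_iterate exists_actX i ?_)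
  rw [hi, hj]
  exact ⟨1, one_mem _, rfl, rfl⟩

lemma isReachable_of_symplectic (t : SymplecticPair) : IsReachable t.1.1 t.1.2 := by
  have h : ∀ p q : HeisLabel, p.2.1 * q.1 = 1 + q.2.1 * p.1 → ∃ n k : Fin 4, ∃ i j : Fin 3,
      let f := fun p => actF^[k] (actD^[j] (actF^[n] (actD^[i] p)))
      ((f p).1, (f p).2.1) = (0, 1) ∧ ((f q).1, (f q).2.1) = (1, 0) := by
    decide +kernel
  obtain ⟨n, k, i, j, hp, hq⟩ := h _ _ t.2
  exact isReachable_of_iterate exists_actD i (isReachable_of_iterate exists_actF n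
    (isReachable_of_iterate exists_actD j (isReachable_of_iterate exists_actF k
      (isReachable_of_linear_eq hp hq))))

lemma det_summand_of_lt (j : Fin 9) : (m (j.castLE (by norm_num))).det = 0 := by
  fin_cases j <;> simp [m, det_fin_three]

lemma det_heis_labelX : (heis labelX).det = 1 := by
  simp [det_fin_three, heis, labelX, zetaChar_zero]

lemma det_heis_labelZ : (heis labelZ).det = 1 := by
  simp [det_fin_three, heis, labelZ, zetaChar_zero, zetaChar_one, zetaChar_two]
  linear_combination zeta_pow_three

lemma exists_heis_of_det_eq_one {φ : Equiv.Perm Mat3} (hφ : φ ∈ pureSymmetries)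
    {p : HeisLabel} (hp : NonCentral p) (hdet : (heis p).det = 1) :
    ∃ q, φ (heis p) = heis q := by
  rw [mem_pureSymmetries] at hφ
  have hlin := isUnitalLinear_of_mem (Or.inl hφ.1)
  obtain ⟨P, rfl⟩ := (isConjugation_iff φ).mp hφ.1
  obtain ⟨i, n, hi⟩ := exists_summand_of_nonCentral p hp
  obtain ⟨j, k, hjk⟩ := hφ.2 i
  have heq : conjPerm P (heis p) = zetaChar (n + k) • m j := by
    rw [hi, hlin.smul, hjk, smul_smul, zetaChar_add]
    rfl
  have h1 : (m j).det = 1 := by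
    have := congr_arg det heq
    rw [conjPerm_apply, det_mul, det_mul, hdet, mul_one, ← det_mul, Units.mul_inv, det_one,
      det_smul, zetaChar, Fintype.card_fin, ← pow_mul, mul_comm _ 3, pow_mul, zeta_pow_three,
      one_pow, one_mul] at this
    exact this.symm
  rw [heq]
  clear hjk heq
  by_cases h : (j : ℕ) < 9
  · have := det_summand_of_lt ⟨j, h⟩
    exact absurd (this.symm.trans h1) zero_ne_one
  · by_cases h' : (j : ℕ) = 9
    · have hj : j = 9 := Fin.ext h'
      rw [hj, m_nine, det_smul, det_one, Fintype.card_fin, a_pow_three] at h1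
      norm_num at h1
    · have hj : Fin.natAdd 10 (⟨j - 10, by omega⟩ : Fin 8) = j := Fin.ext (by simp; omega)
      rw [← hj, m_natAdd, zetaChar_smul_heis]
      exact ⟨_, rfl⟩

lemma exists_symplecticPair {φ : Equiv.Perm Mat3} (hφ : φ ∈ pureSymmetries) :
    ∃ t : SymplecticPair, φ (heis labelX) = heis t.1.1 ∧ φ (heis labelZ) = heis t.1.2 := by
  obtain ⟨p, hp⟩ := exists_heis_of_det_eq_one hφ (by decide) det_heis_labelX
  obtain ⟨q, hq⟩ := exists_heis_of_det_eq_one hφ (by decide) det_heis_labelZ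
  refine ⟨⟨(p, q), ?_⟩, hp, hq⟩
  rw [mem_pureSymmetries] at hφ
  have hlin := isUnitalLinear_of_mem (Or.inl hφ.1)
  obtain ⟨P, rfl⟩ := (isConjugation_iff φ).mp hφ.1
  have hmul (A B : Mat3) : conjPerm P (A * B) = conjPerm P A * conjPerm P B := by
    simp [conjPerm_apply, mul_assoc]
  have hcomm : heis labelX * heis labelZ = zetaChar 1 • (heis labelZ * heis labelX) := by
    rw [heis_mul, heis_mul, zetaChar_smul_heis]
    rfl
  have h := congr_arg (conjPerm P) hcomm
  rw [hlin.smul, hmul, hmul, hp, hq, heis_mul, heis_mul, zetaChar_smul_heis] at h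
  have h' := congr_arg (fun r : HeisLabel => r.2.2) (heis_injective h)
  have key : ∀ c d u v : Fin 3, c + d + u = 1 + (d + c + v) → u = 1 + v := by decide
  exact key _ _ _ _ h'

lemma eq_scalar_of_commute {A : Mat3} (hX : A * heis labelX = heis labelX * A)
    (hZ : A * heis labelZ = heis labelZ * A) : A = A 0 0 • (1 : Mat3) := by
  have hz (i k : Fin 3) (hik : i ≠ k) : A i k = 0 := by
    have h := congr_fun (congr_fun hZ i) k
    simp only [mul_heis_apply, heis_apply_mul, labelZ, zero_add, add_zero, sub_zero, one_mul] at h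
    have : A i k * (zetaChar k - zetaChar i) = 0 := by linear_combination h
    exact (mul_eq_zero.mp this).resolve_right
      (sub_ne_zero.mpr fun h => hik (zetaChar_injective h).symm)
  have hx (i : Fin 3) : A i i = A (i + 1) (i + 1) := by
    have h := congr_fun (congr_fun hX i) (i + 1)
    simpa [mul_heis_apply, heis_apply_mul, labelX, zetaChar_zero] using h
  have h1 : A 0 0 = A 1 1 := hx 0
  have h2 : A 1 1 = A 2 2 := hx 1
  ext i k
  by_cases hik : i = k
  · subst hik
    fin_cases i <;> simp [h1, h2]
  · simp [hz i k hik, hik]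

lemma pureSymmetry_ext {φ ψ : Equiv.Perm Mat3} (hφ : φ ∈ pureSymmetries)
    (hψ : ψ ∈ pureSymmetries) (hX : φ (heis labelX) = ψ (heis labelX))
    (hZ : φ (heis labelZ) = ψ (heis labelZ)) : φ = ψ := by
  obtain ⟨R, hR⟩ := (mul_mem (inv_mem hψ) hφ).1
  have hfix {A : Mat3} (h : φ A = ψ A) : (R : Mat3) * A = A * R := by
    have : conjPerm R A = A := by
      rw [hR, Equiv.Perm.mul_apply, h, Equiv.Perm.inv_def, Equiv.symm_apply_apply]
    rw [conjPerm_apply] at this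
    rw [← Units.mul_inv_eq_iff_eq_mul, this]
  have hs := eq_scalar_of_commute (hfix hX) (hfix hZ)
  have h1 : conjPerm R = 1 := Equiv.ext fun A => by
    have h : (R : Mat3) * A = A * R := by rw [hs]; simp
    rw [conjPerm_apply, h, Units.mul_inv_cancel_right, Equiv.Perm.one_apply]
  rw [h1] at hR
  exact (inv_mul_eq_one.mp hR.symm).symm

lemma card_pureSymmetries : Nat.card pureSymmetries = 216 := by
  choose f hfX hfZ using fun φ : pureSymmetries => exists_symplecticPair φ.2
  rw [← card_symplecticPair]
  refine Nat.card_congr (Equiv.ofBijective f ⟨fun φ ψ h => ?_, fun t => ?_⟩)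
  · exact Subtype.ext (pureSymmetry_ext φ.2 ψ.2 (by rw [hfX, hfX, h]) (by rw [hfZ, hfZ, h]))
  · obtain ⟨φ, hφ, hp, hq⟩ := isReachable_of_symplectic t
    refine ⟨⟨φ, hφ⟩, Subtype.ext (Prod.ext (heis_injective ?_) (heis_injective ?_))⟩
    · rw [← hfX, ← hp]
    · rw [← hfZ, ← hq]

lemma not_isConjugation_and_isTransposeConjugation (φ : Equiv.Perm Mat3) :
    ¬(IsConjugation φ ∧ IsTransposeConjugation φ) := by
  rintro ⟨h, h'⟩
  obtain ⟨P, rfl⟩ := (isConjugation_iff _).mp h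
  obtain ⟨Q, hQ⟩ := (isTransposeConjugation_iff _).mp h'
  have hmul (A B : Mat3) : conjPerm P (A * B) = conjPerm P A * conjPerm P B := by
    simp [conjPerm_apply, mul_assoc]
  have hanti (A B : Mat3) : conjPerm P (A * B) = conjPerm P B * conjPerm P A := by
    simp [hQ, Equiv.Perm.mul_apply, conjPerm_apply, transposePerm_apply, mul_assoc]
  have h : heis labelX * heis labelZ = heis labelZ * heis labelX :=
    (conjPerm P).injective ((hmul _ _).trans (hanti _ _).symm)
  rw [heis_mul, heis_mul] at h
  exact absurd (heis_injective h) (by decide)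

lemma index_pureSymmetries : (pureSymmetries.subgroupOf symmetries).index = 2 := by
  rw [Subgroup.index_eq_two_iff]
  refine ⟨⟨transposePerm, transposePerm_mem_symmetries⟩, fun ⟨φ, hφ⟩ => ?_⟩
  have hφ' := mul_mem hφ transposePerm_mem_symmetries
  rw [mem_symmetries] at hφ hφ'
  have hswap : IsConjugation (φ * transposePerm) ↔ IsTransposeConjugation φ := by
    rw [isConjugation_iff, isTransposeConjugation_iff]
    refine exists_congr fun P => ⟨fun h => ?_, fun h => ?_⟩
    · rw [← h, mul_assoc, transposePerm_mul_self, mul_one]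
    · rw [h, mul_assoc, transposePerm_mul_self, mul_one]
  rw [Subgroup.mem_subgroupOf, Subgroup.mem_subgroupOf]
  change Xor (φ * transposePerm ∈ pureSymmetries) (φ ∈ pureSymmetries)
  rw [mem_pureSymmetries, mem_pureSymmetries, hswap]
  have hnot := not_isConjugation_and_isTransposeConjugation φ
  unfold Xor
  tauto

/-- Theorem 2: the bijections X ↦ PXP⁻¹ or X ↦ PXᵀP⁻¹ preserving the set of
summands up to powers of ζ form a group Γ_S of order 432 under composition, and
the pure conjugations in Γ_S form a normal subgroup of index 2 with 216 elements;
Γ_S ≅ (ℤ₃² ⋊ SL(2,𝔽₃)) ⋊ ℤ₂. -/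
theorem symmetry_group_order_432 :
    ∃ H : Subgroup (Equiv.Perm (Matrix (Fin 3) (Fin 3) ℂ)),
      (∀ φ, φ ∈ H ↔ ((IsConjugation φ ∨ IsTransposeConjugation φ) ∧ FixesDecomposition φ)) ∧
      Nat.card H = 432 ∧
      ∃ K : Subgroup ↥H,
        (∀ ψ : ↥H, ψ ∈ K ↔ IsConjugation ↑ψ) ∧
        K.Normal ∧ K.index = 2 ∧ Nat.card K = 216 := by
  have hK : Nat.card (pureSymmetries.subgroupOf symmetries) = 216 := by
    rw [Nat.card_congr (Subgroup.subgroupOfEquivOfLe pureSymmetries_le).toEquiv,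
      card_pureSymmetries]
  refine ⟨symmetries, mem_symmetries, ?_, pureSymmetries.subgroupOf symmetries, fun ψ => ?_,
    Subgroup.normal_of_index_eq_two index_pureSymmetries, index_pureSymmetries, hK⟩
  · rw [← Subgroup.card_mul_index (pureSymmetries.subgroupOf symmetries), hK,
      index_pureSymmetries]
  · rw [Subgroup.mem_subgroupOf, mem_pureSymmetries]
    exact and_iff_left ((mem_symmetries _).mp ψ.2).2
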